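/- Let Λ be a countable set and let Γ be a subshift of Λ^ω which is a subshift of bounded type. If Z ⊆ Γ is a nonempty closed internally chain transitive set, then there exists x ∈ Γ with ω(x) = Z; moreover x can be chosen so that for every ε > 0 there exists N ∈ ℕ with dist(σ^i(x), Z) < ε for all i ≥ N. -/

import Mathlib

open Set Filter Topology

/-- The shift map `σ` on `ℕ → Λ`, defined by `σ(x)(n) = x(n+1)`. -/
def shift {Λ : Type*} (x : ℕ → Λ) : ℕ → Λ := fun n => x (n + 1)

/-- The Baire metric `d(x,y) = inf {2^{-n} : x_i = y_i for all i < n}`. -/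
noncomputable def bDist {Λ : Type*} (x y : ℕ → Λ) : ℝ :=
  sInf {r : ℝ | ∃ n : ℕ, r = (2 : ℝ)⁻¹ ^ n ∧ ∀ i < n, x i = y i}

/-- `Γ` is a subshift: a closed, shift-invariant subset of `ℕ → Λ`. -/
def IsSubshift {Λ : Type*} [TopologicalSpace Λ] (Γ : Set (ℕ → Λ)) : Prop :=
  IsClosed Γ ∧ shift '' Γ = Γ

/-- The finite word `w` is allowed in `Γ`: it occurs as a consecutive block in some point of `Γ`. -/
def Allowed {Λ : Type*} (Γ : Set (ℕ → Λ)) (w : List Λ) : Prop :=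
  ∃ x ∈ Γ, ∃ i : ℕ, ∀ (j : ℕ) (h : j < w.length), x (i + j) = w.get ⟨j, h⟩

/-- `F` is a basis for the forbidden words of `Γ`: each member of `F` is forbidden, and every
forbidden word contains a member of `F` as a consecutive (infix) subword. -/
def IsForbiddenBasis {Λ : Type*} (Γ : Set (ℕ → Λ)) (F : Set (List Λ)) : Prop :=
  (∀ w ∈ F, ¬ Allowed Γ w) ∧ ∀ w : List Λ, ¬ Allowed Γ w → ∃ v ∈ F, v <:+: w

/-- `Γ` is a subshift of finite type: it has a finite basis for its forbidden words. -/
def IsSFT {Λ : Type*} (Γ : Set (ℕ → Λ)) : Prop :=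
  ∃ F : Set (List Λ), F.Finite ∧ IsForbiddenBasis Γ F

/-- `Γ` is a subshift of bounded type: it has a basis for its forbidden words whose members
have uniformly bounded length. -/
def IsSBT {Λ : Type*} (Γ : Set (ℕ → Λ)) : Prop :=
  ∃ F : Set (List Λ), (∃ N : ℕ, ∀ w ∈ F, w.length ≤ N) ∧ IsForbiddenBasis Γ F

/-- The ω-limit set of a sequence: `⋂_N cl {u i : i ≥ N}`. -/
def omegaSeq {X : Type*} [TopologicalSpace X] (u : ℕ → X) : Set X :=
  ⋂ N : ℕ, closure (u '' Set.Ici N)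

/-- The ω-limit set of a point under the shift map. -/
def omegaPt {Λ : Type*} [TopologicalSpace Λ] (x : ℕ → Λ) : Set (ℕ → Λ) :=
  omegaSeq fun i => shift^[i] x

/-- `A` is internally chain transitive for the shift (w.r.t. the Baire metric): for all
`a, b ∈ A` and `δ > 0` there is a `δ`-chain from `a` to `b` consisting of elements of `A`. -/
def IsICT {Λ : Type*} (A : Set (ℕ → Λ)) : Prop :=
  ∀ a ∈ A, ∀ b ∈ A, ∀ δ : ℝ, 0 < δ → ∃ n : ℕ, 1 ≤ n ∧
    ∃ c : ℕ → (ℕ → Λ), c 0 = a ∧ c n = b ∧ (∀ i ≤ n, c i ∈ A) ∧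
      ∀ i < n, bDist (shift (c i)) (c (i + 1)) < δ

/-- Distance from a point to a set, w.r.t. the Baire metric. -/
noncomputable def bInfDist {Λ : Type*} (x : ℕ → Λ) (Z : Set (ℕ → Λ)) : ℝ :=
  sInf (bDist x '' Z)

theorem forall_eq_of_bDist_lt {Λ : Type*} {x y : ℕ → Λ} {m : ℕ}
    (h : bDist x y < (2 : ℝ)⁻¹ ^ m) : ∀ i < m, x i = y i := by
  obtain ⟨r, ⟨n, rfl, hn⟩, hlt⟩ :=
    exists_lt_of_csInf_lt (by exact ⟨1, 0, by simp⟩) h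
  have hmn : m < n := (pow_lt_pow_iff_right_of_lt_one₀ (by norm_num) (by norm_num)).1 hlt
  exact fun i hi => hn i (hi.trans hmn)

theorem bDist_nonneg {Λ : Type*} (x y : ℕ → Λ) : 0 ≤ bDist x y := by
  apply Real.sInf_nonneg
  rintro r ⟨n, rfl, -⟩
  positivity

theorem bDist_le_of_forall_eq {Λ : Type*} {x y : ℕ → Λ} {m : ℕ}
    (h : ∀ i < m, x i = y i) : bDist x y ≤ (2 : ℝ)⁻¹ ^ m := by
  refine csInf_le ⟨0, ?_⟩ ⟨m, rfl, h⟩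
  rintro r ⟨n, rfl, -⟩
  positivity

theorem bInfDist_le_bDist {Λ : Type*} {x z : ℕ → Λ} {Z : Set (ℕ → Λ)} (hz : z ∈ Z) :
    bInfDist x Z ≤ bDist x z := by
  refine csInf_le ⟨0, ?_⟩ (mem_image_of_mem _ hz)
  rintro _ ⟨w, -, rfl⟩
  exact bDist_nonneg x w

theorem shift_iterate_apply {Λ : Type*} (x : ℕ → Λ) (i n : ℕ) :
    (shift^[i] x) n = x (i + n) := by
  induction i generalizing x with
  | zero => simp
  | succ i ih => rw [Function.iterate_succ_apply, ih, shift]; congr 1; omega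

theorem mem_closure_iff_forall_agree {Λ : Type*} [TopologicalSpace Λ] [DiscreteTopology Λ]
    {x : ℕ → Λ} {S : Set (ℕ → Λ)} :
    x ∈ closure S ↔ ∀ n, ∃ y ∈ S, ∀ i < n, y i = x i := by
  constructor
  · intro hx n
    obtain ⟨y, hy, hyS⟩ := mem_closure_iff.1 hx _ (PiNat.isOpen_cylinder _ x n)
      (PiNat.self_mem_cylinder x n)
    exact ⟨y, hyS, hy⟩
  · intro h
    rw [(PiNat.isTopologicalBasis_cylinders (fun _ : ℕ => Λ)).mem_closure_iff]
    rintro _ ⟨z, n, rfl⟩ hx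
    obtain ⟨y, hyS, hy⟩ := h n
    exact ⟨y, fun i hi => (hy i hi).trans (hx i hi), hyS⟩

theorem mem_omegaPt_iff {Λ : Type*} [TopologicalSpace Λ] [DiscreteTopology Λ] {x z : ℕ → Λ} :
    z ∈ omegaPt x ↔ ∀ N n, ∃ i ≥ N, ∀ j < n, x (i + j) = z j := by
  simp [omegaPt, omegaSeq, mem_closure_iff_forall_agree, shift_iterate_apply]

/-- In a subshift with a basis of forbidden words of length at most `N`, membership is decided
by the blocks of length `N`. -/
theorem mem_of_forall_block {Λ : Type*} [TopologicalSpace Λ] [DiscreteTopology Λ]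
    {Γ : Set (ℕ → Λ)} (hΓ : IsSubshift Γ) {F : Set (List Λ)} {N : ℕ}
    (hN : ∀ w ∈ F, w.length ≤ N) (hF : IsForbiddenBasis Γ F) {x : ℕ → Λ}
    (hx : ∀ i, ∃ y ∈ Γ, ∀ j < N, y j = x (i + j)) : x ∈ Γ := by
  have hshift : ∀ (i : ℕ), ∀ y ∈ Γ, shift^[i] y ∈ Γ := by
    intro i
    induction i with
    | zero => exact fun y hy => hy
    | succ i ih =>
      intro y hy
      rw [Function.iterate_succ_apply]
      exact ih _ (hΓ.2 ▸ mem_image_of_mem shift hy)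
  rw [← hΓ.1.closure_eq, mem_closure_iff_forall_agree]
  intro n
  have hallowed : Allowed Γ (List.ofFn fun i : Fin n => x i) := by
    by_contra hcon
    obtain ⟨v, hvF, s, t, hst⟩ := hF.2 _ hcon
    obtain ⟨y, hy, hyx⟩ := hx s.length
    refine hF.1 v hvF ⟨y, hy, 0, fun j hj => ?_⟩
    rw [zero_add, hyx j (hj.trans_le (hN v hvF))]
    have hget : (s ++ v ++ t)[s.length + j]? = some v[j] := by
      simp [List.getElem?_append, hj]
    rw [hst] at hget
    simp only [List.getElem?_ofFn] at hget
    split at hget <;> simp_all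
  obtain ⟨y, hy, i, hi⟩ := hallowed
  refine ⟨shift^[i] y, hshift i y hy, fun j hj => ?_⟩
  rw [shift_iterate_apply, hi j (by simpa using hj)]
  simp

/-- The position reached after `i` steps when blocks of lengths `n 0, n 1, …` are traversed
consecutively: the index of the current block together with the offset inside it. -/
def blockPos (n : ℕ → ℕ) : ℕ → ℕ × ℕ
  | 0 => (0, 0)
  | i + 1 =>
    if (blockPos n i).2 + 1 < n (blockPos n i).1 then
      ((blockPos n i).1, (blockPos n i).2 + 1)
    else ((blockPos n i).1 + 1, 0)

theorem blockPos_snd_lt {n : ℕ → ℕ} (hn : ∀ k, 1 ≤ n k) (i : ℕ) :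
    (blockPos n i).2 < n (blockPos n i).1 := by
  cases i with
  | zero => exact hn 0
  | succ i =>
    rw [blockPos]
    split_ifs with h
    · exact h
    · exact hn _

theorem blockPos_fst_monotone (n : ℕ → ℕ) : Monotone fun i => (blockPos n i).1 := by
  refine monotone_nat_of_le_succ fun i => ?_
  rw [blockPos]
  split_ifs <;> simp

theorem blockPos_fst_le (n : ℕ → ℕ) (i : ℕ) : (blockPos n i).1 ≤ i := by
  induction i with
  | zero => simp [blockPos]
  | succ i ih =>
    rw [blockPos]
    split_ifs <;> simp <;> omega

theorem exists_blockPos_eq {n : ℕ → ℕ} (hn : ∀ k, 1 ≤ n k) (k : ℕ) :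
    ∃ i, blockPos n i = (k, 0) := by
  induction k with
  | zero => exact ⟨0, rfl⟩
  | succ k ih =>
    obtain ⟨i, hi⟩ := ih
    have hstep : ∀ j < n k, blockPos n (i + j) = (k, j) := by
      intro j
      induction j with
      | zero => exact fun _ => hi
      | succ j ihj =>
        intro hj
        rw [← add_assoc, blockPos, ihj (by omega)]
        exact if_pos hj
    refine ⟨i + (n k - 1) + 1, ?_⟩
    have := hn k
    rw [blockPos, hstep (n k - 1) (by omega)]
    exact if_neg (by dsimp only; omega)

/-- Finite chains joining consecutive terms of `t`, of increasing quality, concatenate to an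
infinite chain that passes through every term of `t`. -/
theorem exists_infinite_chain {X : Type*} {A : Set X} {R : ℕ → X → X → Prop} {t : ℕ → X}
    (h : ∀ k, ∃ n : ℕ, 1 ≤ n ∧ ∃ c : ℕ → X, c 0 = t k ∧ c n = t (k + 1) ∧
      (∀ i ≤ n, c i ∈ A) ∧ ∀ i < n, R k (c i) (c (i + 1))) :
    ∃ (y : ℕ → X) (K : ℕ → ℕ), (∀ i, y i ∈ A) ∧ Monotone K ∧
      (∀ i, R (K i) (y i) (y (i + 1))) ∧ ∀ k, ∃ i ≥ k, K i = k ∧ y i = t k := by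
  choose n hn c hc0 hcn hcA hcR using h
  refine ⟨fun i => c (blockPos n i).1 (blockPos n i).2, fun i => (blockPos n i).1,
    fun i => hcA _ _ (blockPos_snd_lt hn i).le, blockPos_fst_monotone n, fun i => ?_, fun k => ?_⟩
  · have hlt := blockPos_snd_lt hn i
    have hR := hcR _ _ hlt
    have hnext : c (blockPos n (i + 1)).1 (blockPos n (i + 1)).2 =
        c (blockPos n i).1 ((blockPos n i).2 + 1) := by
      rw [blockPos]
      split_ifs with hif
      · rfl
      · rw [show (blockPos n i).2 + 1 = n (blockPos n i).1 by omega, hcn]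
        exact hc0 _
    rwa [← hnext] at hR
  · obtain ⟨i, hi⟩ := exists_blockPos_eq hn k
    refine ⟨i, ?_, by simp only [hi], by simp only [hi, hc0]⟩
    simpa [hi] using blockPos_fst_le n i

/-- A pseudo-orbit agrees on initial segments with the orbit of its sequence of first letters. -/
theorem apply_eq_of_agree {Λ : Type*} {y : ℕ → ℕ → Λ} {i m : ℕ}
    (h : ∀ i' ≥ i, ∀ l < m, y i' (l + 1) = y (i' + 1) l) {l : ℕ} (hl : l ≤ m) :
    y (i + l) 0 = y i l := by
  have key : ∀ p q, p + q ≤ m → y i (p + q) = y (i + p) q := by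
    intro p
    induction p with
    | zero => simp
    | succ p ih =>
      intro q hq
      rw [show p + 1 + q = p + (q + 1) by omega, ih _ (by omega),
        h (i + p) (by omega) q (by omega), add_assoc]
  exact (key l 0 hl).symm

/-- In a subshift of bounded type over a countable alphabet, every nonempty closed internally
chain transitive subset `Z` is the ω-limit set of a point `x ∈ Γ`; moreover `x` can be chosen
so that its orbit is eventually within `ε` of `Z` for every `ε > 0`. -/
theorem sbt_ict_attracting_omega {Λ : Type*} [TopologicalSpace Λ] [DiscreteTopology Λ]
    [Countable Λ] (Γ : Set (ℕ → Λ)) (hΓ : IsSubshift Γ) (hSBT : IsSBT Γ)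
    (Z : Set (ℕ → Λ)) (hZΓ : Z ⊆ Γ) (hne : Z.Nonempty) (hcl : IsClosed Z) (hict : IsICT Z) :
    ∃ x ∈ Γ, omegaPt x = Z ∧
      ∀ ε : ℝ, 0 < ε → ∃ N : ℕ, ∀ i : ℕ, N ≤ i → bInfDist (shift^[i] x) Z < ε := by
  obtain ⟨F, ⟨N, hN⟩, hF⟩ := hSBT
  have : Nonempty Z := hne.to_subtype
  obtain ⟨d, hd⟩ := TopologicalSpace.exists_dense_seq Z
  have hchain : ∀ k : ℕ, ∃ n : ℕ, 1 ≤ n ∧ ∃ c : ℕ → (ℕ → Λ),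
      c 0 = d (Nat.unpair k).1 ∧ c n = d (Nat.unpair (k + 1)).1 ∧ (∀ i ≤ n, c i ∈ Z) ∧
      ∀ i < n, bDist (shift (c i)) (c (i + 1)) < (2 : ℝ)⁻¹ ^ (k + N) :=
    fun k => hict _ (d _).2 _ (d _).2 _ (by positivity)
  obtain ⟨y, K, hyZ, hK, hyR, hyt⟩ := exists_infinite_chain (t := fun k => (d (Nat.unpair k).1).1)
    (R := fun k a b => bDist (shift a) b < (2 : ℝ)⁻¹ ^ (k + N)) hchain
  have hagree : ∀ i, ∀ l ≤ K i + N, y (i + l) 0 = y i l := fun i l hl =>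
    apply_eq_of_agree (fun i' hi' p hp => forall_eq_of_bDist_lt (hyR i') p
      (hp.trans_le (Nat.add_le_add_right (hK hi') N))) hl
  have hKlarge : ∀ k, ∃ M, ∀ i ≥ M, k ≤ K i := by
    intro k
    obtain ⟨M, -, hM, -⟩ := hyt k
    exact ⟨M, fun i hi => hM ▸ hK hi⟩
  refine ⟨fun i => y i 0, ?_, ?_, fun ε hε => ?_⟩
  · exact mem_of_forall_block hΓ hN hF fun i =>
      ⟨y i, hZΓ (hyZ i), fun j hj => (hagree i j (by omega)).symm⟩
  · ext z
    rw [mem_omegaPt_iff]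
    constructor
    · intro hz
      rw [← hcl.closure_eq, mem_closure_iff_forall_agree]
      intro n
      obtain ⟨M, hM⟩ := hKlarge n
      obtain ⟨i, hi, hiz⟩ := hz M n
      refine ⟨y i, hyZ i, fun j hj => ?_⟩
      rw [← hiz j hj, hagree i j (by have := hM i hi; omega)]
    · intro hz M n
      have hzd : z ∈ closure (range fun m => (d m).1) := by
        have := closure_subtype.1 (hd ⟨z, hz⟩)
        rwa [← range_comp] at this
      obtain ⟨_, ⟨m, rfl⟩, hm⟩ := mem_closure_iff_forall_agree.1 hzd n
      obtain ⟨i, hi, hKi, hyi⟩ := hyt (Nat.pair m (M + n))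
      have hle := Nat.right_le_pair m (M + n)
      refine ⟨i, by omega, fun j hj => ?_⟩
      simp only [hagree i j (by omega), hyi, Nat.unpair_pair, hm j hj]
  · obtain ⟨k, hk⟩ := exists_pow_lt_of_lt_one hε (by norm_num : (2 : ℝ)⁻¹ < 1)
    obtain ⟨M, hM⟩ := hKlarge k
    refine ⟨M, fun i hi => ((bInfDist_le_bDist (hyZ i)).trans
      (bDist_le_of_forall_eq fun j hj => ?_)).trans_lt hk⟩
    rw [shift_iterate_apply, hagree i j (by have := hM i hi; omega)]
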